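/- (Polynomial case of Theorem 1.3 / Theorem 3.10.) Let φ ∈ O_L[X] be a polynomial of degree d ≥ 2 with good reduction. Then the number of connected components of the fixed point locus Fix(φ) ⊆ A¹_an (with the topology of pointwise convergence) is at most d + 1. -/

import Mathlib

open Polynomial

/-- A point of the Berkovich affine line `A¹_an` over `L`: a multiplicative ring seminorm
on `L[X]` whose restriction to the constant polynomials is the given absolute value of `L`. -/
structure BerkovichPoint (L : Type*) [NontriviallyNormedField L] where
  toFun : Polynomial L → ℝ
  nonneg' : ∀ P, 0 ≤ toFun P
  map_mul' : ∀ P Q, toFun (P * Q) = toFun P * toFun Q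
  add_le' : ∀ P Q, toFun (P + Q) ≤ toFun P + toFun Q
  const' : ∀ a : L, toFun (C a) = ‖a‖

namespace BerkovichPoint

variable {L : Type*} [NontriviallyNormedField L]

/-- The topology of pointwise convergence on the Berkovich affine line. -/
instance : TopologicalSpace (BerkovichPoint L) :=
  TopologicalSpace.induced (fun x => x.toFun) Pi.topologicalSpace

/-- The Gauss norm of a polynomial: the maximum of the absolute values of its coefficients.
The Gauss point `ζ_G` is the point of the Berkovich affine line given by this seminorm. -/
noncomputable def gaussNorm (P : Polynomial L) : ℝ := ⨆ i : ℕ, ‖P.coeff i‖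

/-- The type 1 (evaluation) point of the Berkovich affine line attached to `a ∈ L`:
`ev_a(P) = ‖P(a)‖`. -/
noncomputable def evPoint (a : L) : BerkovichPoint L where
  toFun P := ‖P.eval a‖
  nonneg' P := norm_nonneg _
  map_mul' P Q := by simp
  add_le' P Q := by simp only [eval_add]; exact norm_add_le _ _
  const' b := by simp

/-- The action of a polynomial `φ` on the Berkovich affine line by pushforward:
`(φ_* x)(P) = x(P ∘ φ)`.  The fixed point locus of `φ` is `{x | pushforward φ x = x}`. -/
noncomputable def pushforward (φ : Polynomial L) (x : BerkovichPoint L) : BerkovichPoint L where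
  toFun P := x.toFun (P.comp φ)
  nonneg' P := x.nonneg' _
  map_mul' P Q := by simp only [mul_comp]; exact x.map_mul' _ _
  add_le' P Q := by simp only [add_comp]; exact x.add_le' _ _
  const' a := by simp only [C_comp]; exact x.const' a

end BerkovichPoint

open BerkovichPoint

theorem AbsoluteValue.isNonarchimedean_of_natCast_le_one {R : Type*} [CommRing R]
    [Nontrivial R] (v : AbsoluteValue R ℝ) (h : ∀ n : ℕ, v n ≤ 1) : IsNonarchimedean v := by
  intro a b
  by_contra! hlt
  set M := max (v a) (v b) with hM
  have hM0 : 0 ≤ M := (v.nonneg a).trans (le_max_left _ _)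
  rcases hM0.eq_or_lt with h0 | hpos
  · have ha : v a ≤ M := le_max_left _ _
    have hb : v b ≤ M := le_max_right _ _
    linarith [v.add_le a b]
  obtain ⟨m, hm⟩ := Real.exists_natCast_add_one_lt_pow_of_one_lt ((one_lt_div hpos).2 hlt)
  rw [div_pow, lt_div_iff₀ (by positivity)] at hm
  refine hm.not_ge ?_
  rw [← map_pow, add_pow]
  refine (v.sum_le _ _).trans ?_
  calc ∑ k ∈ Finset.range (m + 1), v (a ^ k * b ^ (m - k) * (m.choose k : R))
      ≤ ∑ k ∈ Finset.range (m + 1), M ^ m := by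
        refine Finset.sum_le_sum fun k hk ↦ ?_
        have hk' : k + (m - k) = m := by have := Finset.mem_range.1 hk; omega
        rw [map_mul, map_mul, map_pow, map_pow]
        calc v a ^ k * v b ^ (m - k) * v (m.choose k : R)
            ≤ M ^ k * M ^ (m - k) * 1 := by
              gcongr
              · exact le_max_left _ _
              · exact le_max_right _ _
              · exact h _
          _ = M ^ m := by rw [mul_one, ← pow_add, hk']
    _ = (m + 1) * M ^ m := by simp

namespace Polynomial

section GaussNorm

variable {R : Type*} [CommRing R] {v : AbsoluteValue R ℝ}

theorem apply_eval_le_gaussNorm [Nontrivial R] (hv : IsNonarchimedean v) (p : R[X]) (y : R) :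
    v (p.eval y) ≤ Polynomial.gaussNorm v (v y) p := by
  rw [eval_eq_sum_range]
  refine (hv.apply_sum_le_sup Finset.nonempty_range_add_one).trans (Finset.sup'_le _ _ ?_)
  intro i _
  rw [map_mul, map_pow]
  exact le_gaussNorm v p (v.nonneg y) i

theorem gaussNorm_eq_max (p : R[X]) {t : ℝ} (ht : 0 ≤ t) :
    Polynomial.gaussNorm v t p =
      max (v (p.coeff 0)) (Polynomial.gaussNorm v t (p - C (p.coeff 0))) := by
  have hc (i : ℕ) (hi : i ≠ 0) : (p - C (p.coeff 0)).coeff i = p.coeff i := by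
    simp [coeff_C, hi]
  apply le_antisymm
  · obtain ⟨i, hi⟩ := exists_eq_gaussNorm v t p
    rcases eq_or_ne i 0 with rfl | h0
    · rw [hi]
      simp
    · rw [hi, ← hc i h0]
      exact (le_gaussNorm v _ ht i).trans (le_max_right _ _)
  · refine max_le ?_ ?_
    · simpa using le_gaussNorm v p ht 0
    · obtain ⟨i, hi⟩ := exists_eq_gaussNorm v t (p - C (p.coeff 0))
      rcases eq_or_ne i 0 with rfl | h0
      · rw [hi]
        simpa using gaussNorm_nonneg v p ht
      · rw [hi, hc i h0]
        exact le_gaussNorm v p ht i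

theorem mul_gaussNorm_le_mul_gaussNorm (p : R[X]) (hp : p.coeff 0 = 0) {t u : ℝ}
    (ht : 0 ≤ t) (htu : t ≤ u) :
    u * Polynomial.gaussNorm v t p ≤ t * Polynomial.gaussNorm v u p := by
  obtain ⟨i, hi⟩ := exists_eq_gaussNorm v t p
  have hu := ht.trans htu
  cases i with
  | zero =>
    have h0 := mul_nonneg ht (gaussNorm_nonneg v p hu)
    simpa [hi, hp] using h0
  | succ i =>
    calc u * Polynomial.gaussNorm v t p
        = t * (v (p.coeff (i + 1)) * (t ^ i * u)) := by rw [hi]; ring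
      _ ≤ t * (v (p.coeff (i + 1)) * (u ^ i * u)) := by gcongr
      _ = t * (v (p.coeff (i + 1)) * u ^ (i + 1)) := by rw [pow_succ]
      _ ≤ t * Polynomial.gaussNorm v u p := by gcongr; exact le_gaussNorm v p hu _

theorem continuous_gaussNorm (p : R[X]) : Continuous fun t ↦ Polynomial.gaussNorm v t p := by
  unfold Polynomial.gaussNorm
  split_ifs with h
  · exact Continuous.finset_sup'_apply h fun i _ ↦ by fun_prop
  · exact continuous_const

end GaussNorm

end Polynomial

namespace BerkovichPoint

variable {L : Type*} [NontriviallyNormedField L]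

theorem continuous_iff {T : Type*} [TopologicalSpace T] {f : T → BerkovichPoint L} :
    Continuous f ↔ ∀ P, Continuous fun t ↦ (f t).toFun P := by
  rw [continuous_induced_rng, continuous_pi_iff]
  rfl

theorem toFun_injective : Function.Injective (toFun (L := L)) := by
  rintro ⟨f, _, _, _, _⟩ ⟨g, _, _, _, _⟩ h
  congr

/-- A point of the Berkovich affine line as a multiplicative map. -/
def toMonoidHom (x : BerkovichPoint L) : L[X] →* ℝ where
  toFun := x.toFun
  map_one' := by simpa using x.const' 1
  map_mul' := x.map_mul'

theorem toFun_eq_prod_roots [IsAlgClosed L] (x : BerkovichPoint L) (P : L[X]) :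
    x.toFun P = ‖P.leadingCoeff‖ * (P.roots.map fun a ↦ x.toFun (X - C a)).prod := by
  conv_lhs => rw [(IsAlgClosed.splits P).eq_prod_roots, x.map_mul', x.const']
  congr 1
  exact (map_multiset_prod x.toMonoidHom _).trans (by rw [Multiset.map_map]; rfl)

theorem ext_of_X_sub_C [IsAlgClosed L] {x y : BerkovichPoint L}
    (h : ∀ a, x.toFun (X - C a) = y.toFun (X - C a)) : x = y :=
  toFun_injective <| funext fun P ↦ by
    rw [toFun_eq_prod_roots x, toFun_eq_prod_roots y]
    simp only [h]

theorem toFun_neg (x : BerkovichPoint L) (P : L[X]) : x.toFun (-P) = x.toFun P := by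
  have h := x.map_mul' (C (-1)) P
  rw [x.const'] at h
  simpa using h

theorem toFun_sub_le (x : BerkovichPoint L) (P Q R : L[X]) :
    x.toFun (P - R) ≤ x.toFun (P - Q) + x.toFun (Q - R) := by
  simpa using x.add_le' (P - Q) (Q - R)

theorem pushforward_eq_iff [IsAlgClosed L] {φ : L[X]} {x : BerkovichPoint L} :
    pushforward φ x = x ↔ ∀ b, x.toFun (φ - C b) = x.toFun (X - C b) := by
  refine ⟨fun h b ↦ ?_, fun h ↦ ext_of_X_sub_C fun b ↦ ?_⟩
  · conv_rhs => rw [← h]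
    simp [pushforward]
  · simpa [pushforward] using h b

/-- The radius of a point of the Berkovich affine line. -/
noncomputable def radius (x : BerkovichPoint L) : ℝ := ⨅ a : L, x.toFun (X - C a)

theorem radius_le (x : BerkovichPoint L) (a : L) : x.radius ≤ x.toFun (X - C a) :=
  ciInf_le ⟨0, by rintro _ ⟨a, rfl⟩; exact x.nonneg' _⟩ a

theorem radius_nonneg (x : BerkovichPoint L) : 0 ≤ x.radius :=
  Real.iInf_nonneg fun _ ↦ x.nonneg' _

theorem exists_lt_of_radius_lt {x : BerkovichPoint L} {r : ℝ} (h : x.radius < r) :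
    ∃ a, x.toFun (X - C a) < r :=
  exists_lt_of_ciInf_lt h

theorem eq_evPoint_of_toFun_eq_zero [IsAlgClosed L] {x : BerkovichPoint L} {a : L}
    (h : x.toFun (X - C a) = 0) : x = evPoint a := by
  refine ext_of_X_sub_C fun b ↦ ?_
  have hab (a b : L) : x.toFun (C a - C b) = ‖a - b‖ := by rw [← C_sub, x.const']
  have h₁ := x.toFun_sub_le X (C a) (C b)
  have h₂ := x.toFun_sub_le (C a) X (C b)
  rw [← neg_sub X (C a), toFun_neg] at h₂
  rw [hab] at h₁ h₂
  simp only [evPoint, eval_sub, eval_X, eval_C]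
  linarith

theorem exists_eq_evPoint_of_radius_eq_zero [IsAlgClosed L] [CompleteSpace L]
    {x : BerkovichPoint L} (h : x.radius = 0) : ∃ a, x = evPoint a := by
  have hex (n : ℕ) : ∃ a, x.toFun (X - C a) < 1 / ((n : ℝ) + 1) :=
    exists_lt_of_radius_lt (h ▸ Nat.one_div_pos_of_nat)
  choose a ha using hex
  have hab (b c : L) : ‖b - c‖ ≤ x.toFun (X - C b) + x.toFun (X - C c) := by
    rw [← x.const', C_sub, ← toFun_neg x (X - C b), neg_sub]
    exact x.toFun_sub_le _ _ _
  have hlim : Filter.Tendsto (fun n ↦ x.toFun (X - C (a n))) Filter.atTop (nhds 0) :=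
    squeeze_zero (fun _ ↦ x.nonneg' _) (fun n ↦ (ha n).le) tendsto_one_div_add_atTop_nhds_zero_nat
  have hcauchy : CauchySeq a := by
    rw [cauchySeq_iff_tendsto_dist_atTop_0]
    refine squeeze_zero (fun _ ↦ dist_nonneg)
      (fun p ↦ (dist_eq_norm (a p.1) (a p.2)).trans_le (hab _ _)) ?_
    rw [← Filter.prod_atTop_atTop_eq]
    simpa using (hlim.comp Filter.tendsto_fst).add (hlim.comp Filter.tendsto_snd)
  obtain ⟨b, hb⟩ := cauchySeq_tendsto_of_complete hcauchy
  refine ⟨b, eq_evPoint_of_toFun_eq_zero (le_antisymm ?_ (x.nonneg' _))⟩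
  have hnorm : Filter.Tendsto (fun n ↦ ‖a n - b‖) Filter.atTop (nhds 0) :=
    tendsto_iff_norm_sub_tendsto_zero.1 hb
  refine ge_of_tendsto' (by simpa using hlim.add hnorm) fun n ↦ ?_
  rw [← x.const', C_sub]
  exact x.toFun_sub_le _ _ _

/-- A point of positive radius as an absolute value on `L[X]`. -/
noncomputable def toAbsoluteValue [IsAlgClosed L] (x : BerkovichPoint L) (hx : 0 < x.radius) :
    AbsoluteValue L[X] ℝ where
  toFun := x.toFun
  map_mul' := x.map_mul'
  nonneg' := x.nonneg'
  eq_zero' P := by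
    refine ⟨fun h ↦ ?_, fun h ↦ by simpa [h] using x.const' 0⟩
    rw [toFun_eq_prod_roots, mul_eq_zero, Multiset.prod_eq_zero_iff] at h
    rcases h with h | h
    · simpa using h
    · obtain ⟨a, -, ha⟩ := Multiset.mem_map.1 h
      exact absurd ha (hx.trans_le (x.radius_le a)).ne'
  add_le' := x.add_le'

section Thicken

variable [IsAlgClosed L] {x : BerkovichPoint L} (hx : 0 < x.radius)

@[simp]
theorem toAbsoluteValue_apply (P : L[X]) : x.toAbsoluteValue hx P = x.toFun P := rfl

theorem isNonarchimedean_toAbsoluteValue (hna : IsNonarchimedean (fun a : L ↦ ‖a‖)) :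
    IsNonarchimedean (x.toAbsoluteValue hx) := by
  refine AbsoluteValue.isNonarchimedean_of_natCast_le_one _ fun n ↦ ?_
  have := IsUltrametricDist.isUltrametricDist_of_isNonarchimedean_norm hna
  have h := x.const' (n : L)
  rw [map_natCast] at h
  exact h.trans_le (IsUltrametricDist.norm_natCast_le_one L n)

theorem toFun_le_pow_natDegree (hna : IsNonarchimedean (fun a : L ↦ ‖a‖)) (hx : 0 < x.radius)
    {P : L[X]} (hP : ∀ i, ‖P.coeff i‖ ≤ 1) {r : ℝ} (hr : 1 ≤ r) (hXr : x.toFun X ≤ r) :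
    x.toFun P ≤ r ^ P.natDegree := by
  have h := apply_eval_le_gaussNorm (isNonarchimedean_toAbsoluteValue hx hna) (P.map C) X
  rw [eval_map, eval₂_C_X] at h
  refine h.trans ?_
  obtain ⟨i, hi⟩ := exists_eq_gaussNorm (x.toAbsoluteValue hx) (x.toFun X) (P.map C)
  rw [toAbsoluteValue_apply, hi, coeff_map, toAbsoluteValue_apply, x.const']
  rcases le_or_gt i P.natDegree with hle | hlt
  · calc ‖P.coeff i‖ * x.toFun X ^ i ≤ 1 * r ^ i := by
          gcongr
          · exact pow_nonneg (x.nonneg' _) _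
          · exact hP i
          · exact x.nonneg' _
      _ ≤ r ^ P.natDegree := by rw [one_mul]; exact pow_le_pow_right₀ hr hle
  · rw [coeff_eq_zero_of_natDegree_lt hlt]
    simp only [norm_zero, zero_mul]
    positivity

/-- The point obtained from `x` by increasing its radius to `t`. As `t` grows, these points
trace the path from `x` to infinity. -/
noncomputable def thicken (hna : IsNonarchimedean (fun a : L ↦ ‖a‖)) (hx : 0 < x.radius) (t : ℝ)
    (ht : 0 < t) : BerkovichPoint L where
  toFun P := Polynomial.gaussNorm (x.toAbsoluteValue hx) t (taylor X (P.map C))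
  nonneg' P := gaussNorm_nonneg _ _ ht.le
  map_mul' P Q := by
    rw [Polynomial.map_mul, taylor_mul,
      gaussNorm_mul (isNonarchimedean_toAbsoluteValue hx hna) ht]
  add_le' P Q := by
    rw [Polynomial.map_add, map_add]
    exact (isNonarchimedean_gaussNorm _ (isNonarchimedean_toAbsoluteValue hx hna) ht.le).add_le
      fun P ↦ gaussNorm_nonneg _ _ ht.le
  const' a := by simpa using x.const' a

/-- The part of `φ (X + Y)` without constant term in `Y`, as a polynomial in `Y` over `L[X]`. -/
noncomputable def increment (φ : L[X]) : L[X][X] := taylor X (φ.map C) - C φ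

omit [IsAlgClosed L] in
theorem increment_coeff_zero (φ : L[X]) : (increment φ).coeff 0 = 0 := by
  simp [increment, taylor_coeff_zero, eval_map]

theorem thicken_sub_C (hna : IsNonarchimedean (fun a : L ↦ ‖a‖)) {t : ℝ} (ht : 0 < t)
    (φ : L[X]) (b : L) : (thicken hna hx t ht).toFun (φ - C b) =
      max (x.toFun (φ - C b)) (Polynomial.gaussNorm (x.toAbsoluteValue hx) t (increment φ)) := by
  have h0 : (taylor X ((φ - C b).map C)).coeff 0 = φ - C b := by
    simp [taylor_coeff_zero, eval_map]
  change Polynomial.gaussNorm _ t _ = _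
  rw [gaussNorm_eq_max _ ht.le, h0, toAbsoluteValue_apply]
  congr 2
  simp [increment]

theorem thicken_X_sub_C (hna : IsNonarchimedean (fun a : L ↦ ‖a‖)) {t : ℝ} (ht : 0 < t)
    (b : L) : (thicken hna hx t ht).toFun (X - C b) = max (x.toFun (X - C b)) t := by
  rw [thicken_sub_C]
  congr 1
  have h : increment (X : L[X]) = monomial 1 1 := by simp [increment, X]
  rw [h, gaussNorm_monomial]
  simp

theorem continuous_thicken (hna : IsNonarchimedean (fun a : L ↦ ‖a‖)) {s : Set ℝ}
    (hs : ∀ t ∈ s, 0 < t) : Continuous fun t : s ↦ thicken hna hx t (hs t t.2) :=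
  continuous_iff.2 fun _ ↦ (continuous_gaussNorm _).comp continuous_subtype_val

theorem thicken_radius (hna : IsNonarchimedean (fun a : L ↦ ‖a‖)) :
    thicken hna hx x.radius hx = x :=
  ext_of_X_sub_C fun b ↦ by rw [thicken_X_sub_C, max_eq_left (x.radius_le b)]

theorem thicken_one_X_sub_C (hna : IsNonarchimedean (fun a : L ↦ ‖a‖)) (hX : x.toFun X ≤ 1)
    (b : L) : (thicken hna hx 1 one_pos).toFun (X - C b) = max ‖b‖ 1 := by
  rw [thicken_X_sub_C]
  have hn := isNonarchimedean_toAbsoluteValue hx hna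
  have h₁ := hn X (-C b)
  have h₂ := hn (X - C b) (-X)
  rw [← sub_eq_add_neg] at h₁
  rw [sub_add_eq_add_sub, add_neg_cancel, zero_sub] at h₂
  simp only [toAbsoluteValue_apply, toFun_neg, x.const'] at h₁ h₂
  apply le_antisymm
  · exact max_le (h₁.trans (max_le (hX.trans (le_max_right _ _)) (le_max_left _ _)))
      (le_max_right _ _)
  · exact max_le (h₂.trans (max_le_max le_rfl hX)) (le_max_right _ _)

end Thicken

section Fixed

variable [IsAlgClosed L] {x : BerkovichPoint L} {φ : L[X]}

theorem toFun_X_le_one_of_pushforward_eq (hna : IsNonarchimedean (fun a : L ↦ ‖a‖))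
    (hx : 0 < x.radius) (hfix : pushforward φ x = x) (hd : 2 ≤ φ.natDegree)
    (hcoeff : ∀ i, ‖φ.coeff i‖ ≤ 1) (hlead : ‖φ.leadingCoeff‖ = 1) : x.toFun X ≤ 1 := by
  by_contra! h1
  have hφ : x.toFun φ = x.toFun X := by simpa using pushforward_eq_iff.1 hfix 0
  have herase : x.toFun φ.eraseLead ≤ x.toFun X ^ (φ.natDegree - 1) := by
    refine (toFun_le_pow_natDegree hna hx (fun i ↦ ?_) h1.le le_rfl).trans
      (pow_le_pow_right₀ h1.le φ.eraseLead_natDegree_le)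
    rw [eraseLead_coeff]
    split_ifs <;> simp [hcoeff]
  have hlt : x.toFun X ^ (φ.natDegree - 1) < x.toFun X ^ φ.natDegree :=
    pow_lt_pow_right₀ h1 (by omega)
  have hle : x.toFun X ≤ x.toFun X ^ (φ.natDegree - 1) := le_self_pow₀ h1.le (by omega)
  have hmain := isNonarchimedean_toAbsoluteValue hx hna φ (-φ.eraseLead)
  rw [← sub_eq_add_neg, ← self_sub_C_mul_X_pow, sub_sub_cancel, map_mul, map_pow,
    self_sub_C_mul_X_pow] at hmain
  simp only [toAbsoluteValue_apply, x.const', hlead, one_mul, toFun_neg, hφ] at hmain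
  exact absurd (hmain.trans (max_le hle herase)) hlt.not_ge

theorem gaussNorm_increment_eq (hna : IsNonarchimedean (fun a : L ↦ ‖a‖))
    (hx : 0 < x.radius) (hfix : pushforward φ x = x) (hX : x.toFun X ≤ 1)
    (hcoeff : ∀ i, ‖φ.coeff i‖ ≤ 1) {t : ℝ} (hrt : x.radius ≤ t) (ht1 : t ≤ 1) :
    Polynomial.gaussNorm (x.toAbsoluteValue hx) t (increment φ) = t := by
  have ht := hx.trans_le hrt
  apply le_antisymm
  · have hmono := mul_gaussNorm_le_mul_gaussNorm (v := x.toAbsoluteValue hx) _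
      (increment_coeff_zero φ) ht.le ht1
    have hpos : 0 < (thicken hna hx 1 one_pos).radius := by
      refine one_pos.trans_le (le_ciInf fun a ↦ ?_)
      rw [thicken_X_sub_C]
      exact le_max_right _ _
    have hone : (thicken hna hx 1 one_pos).toFun φ ≤ 1 := by
      have h := toFun_le_pow_natDegree hna hpos hcoeff le_rfl
        (by simpa using (thicken_one_X_sub_C hx hna hX 0).le)
      simpa using h
    have hs : Polynomial.gaussNorm (x.toAbsoluteValue hx) 1 (increment φ) ≤ 1 := by
      have h := thicken_sub_C hx hna one_pos φ 0
      rw [C_0, sub_zero] at h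
      exact (le_max_right _ _).trans (h.ge.trans hone)
    nlinarith
  · have hlower (a : L) : x.radius ≤
        Polynomial.gaussNorm (x.toAbsoluteValue hx) (x.toFun (X - C a)) (increment φ) := by
      have h := apply_eval_le_gaussNorm (isNonarchimedean_toAbsoluteValue hx hna)
        (increment φ) (C a - X)
      have heval : (increment φ).eval (C a - X) = -(φ - C (φ.eval a)) := by
        simp [increment, taylor_eval]
      rw [heval, toAbsoluteValue_apply, toAbsoluteValue_apply, toFun_neg,
        pushforward_eq_iff.1 hfix, ← neg_sub X, toFun_neg] at h
      exact (x.radius_le _).trans h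
    have hr : x.radius ≤
        Polynomial.gaussNorm (x.toAbsoluteValue hx) x.radius (increment φ) := by
      by_contra! hlt
      obtain ⟨ε, hε, hball⟩ := Metric.eventually_nhds_iff.1
        ((continuous_gaussNorm (v := x.toAbsoluteValue hx)
          (increment φ)).continuousAt.eventually_lt continuousAt_const hlt)
      obtain ⟨a, ha⟩ := exists_lt_of_radius_lt (lt_add_of_pos_right x.radius hε)
      refine (hlower a).not_gt (hball ?_)
      rw [Real.dist_eq, abs_of_nonneg (sub_nonneg.2 (x.radius_le a))]
      linarith
    have hmono := mul_gaussNorm_le_mul_gaussNorm (v := x.toAbsoluteValue hx) _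
      (increment_coeff_zero φ) hx.le hrt
    refine le_of_mul_le_mul_left ?_ hx
    nlinarith

theorem pushforward_thicken (hna : IsNonarchimedean (fun a : L ↦ ‖a‖))
    (hx : 0 < x.radius) (hfix : pushforward φ x = x) (hX : x.toFun X ≤ 1)
    (hcoeff : ∀ i, ‖φ.coeff i‖ ≤ 1) {t : ℝ} (hrt : x.radius ≤ t) (ht1 : t ≤ 1) :
    pushforward φ (thicken hna hx t (hx.trans_le hrt)) = thicken hna hx t (hx.trans_le hrt) := by
  refine pushforward_eq_iff.2 fun b ↦ ?_
  rw [thicken_sub_C, thicken_X_sub_C, gaussNorm_increment_eq hna hx hfix hX hcoeff hrt ht1,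
    pushforward_eq_iff.1 hfix]

/-- The fixed points of positive radius are all joined, inside the fixed locus, to the Gauss
point, which is `thicken hna hx 1 one_pos` for each of them. -/
theorem connectedComponent_eq_of_radius_pos (hna : IsNonarchimedean (fun a : L ↦ ‖a‖))
    (hd : 2 ≤ φ.natDegree) (hcoeff : ∀ i, ‖φ.coeff i‖ ≤ 1) (hlead : ‖φ.leadingCoeff‖ = 1)
    (x y : {x : BerkovichPoint L | pushforward φ x = x}) (hx : 0 < x.1.radius)
    (hy : 0 < y.1.radius) : connectedComponent x = connectedComponent y := by
  have hX (z : {x : BerkovichPoint L | pushforward φ x = x}) (hz : 0 < z.1.radius) :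
      z.1.toFun X ≤ 1 := toFun_X_le_one_of_pushforward_eq hna hz z.2 hd hcoeff hlead
  have hr (z : {x : BerkovichPoint L | pushforward φ x = x}) (hz : 0 < z.1.radius) :
      z.1.radius ≤ 1 := (z.1.radius_le 0).trans (by simpa using hX z hz)
  have hgauss (z : {x : BerkovichPoint L | pushforward φ x = x}) (hz : 0 < z.1.radius) :
      connectedComponent z = connectedComponent
        ⟨thicken hna hz 1 one_pos, pushforward_thicken hna hz z.2 (hX z hz) hcoeff
          (hr z hz) le_rfl⟩ := by
    let f : Set.Icc z.1.radius 1 → {x : BerkovichPoint L | pushforward φ x = x} := fun t ↦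
      ⟨thicken hna hz t (hz.trans_le t.2.1),
        pushforward_thicken hna hz z.2 (hX z hz) hcoeff t.2.1 t.2.2⟩
    have hf : Continuous f :=
      (continuous_thicken hz hna fun t ht ↦ hz.trans_le ht.1).subtype_mk _
    have : PreconnectedSpace (Set.Icc z.1.radius 1) :=
      Subtype.preconnectedSpace isPreconnected_Icc
    refine connectedComponent_eq ?_
    refine (isPreconnected_range hf).subset_connectedComponent
      ⟨⟨z.1.radius, le_rfl, hr z hz⟩, ?_⟩ ⟨⟨1, hr z hz, le_rfl⟩, rfl⟩
    exact Subtype.ext (thicken_radius hz hna)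
  rw [hgauss x hx, hgauss y hy]
  congr 2
  refine ext_of_X_sub_C fun b ↦ ?_
  rw [thicken_one_X_sub_C hx hna (hX x hx), thicken_one_X_sub_C hy hna (hX y hy)]

omit [IsAlgClosed L] in
theorem eval_eq_of_pushforward_evPoint_eq {a : L} (h : pushforward φ (evPoint a) = evPoint a) :
    φ.eval a = a := by
  have h' := congrArg (fun y ↦ y.toFun (X - C a)) h
  simpa [pushforward, evPoint, sub_eq_zero] using h'

end Fixed

end BerkovichPoint

/-- Polynomial case of Theorem 1.3 / Theorem 3.10: for a polynomial `φ ∈ O_L[X]` of degree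
`d ≥ 2` with good reduction, the fixed point locus `Fix(φ) ⊆ A¹_an` (with the topology of
pointwise convergence) has at most `d + 1` connected components. -/
theorem fixed_locus_number_of_components_le
    (L : Type*) [NontriviallyNormedField L] [CompleteSpace L] [IsAlgClosed L] [CharZero L]
    (hna : IsNonarchimedean (fun x : L => ‖x‖))
    (φ : L[X]) (d : ℕ) (hd : 2 ≤ d) (hdeg : φ.natDegree = d)
    (hcoeff : ∀ i, ‖φ.coeff i‖ ≤ 1) (hlead : ‖φ.leadingCoeff‖ = 1) :
    Finite (ConnectedComponents {x : BerkovichPoint L | pushforward φ x = x}) ∧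
    Nat.card (ConnectedComponents {x : BerkovichPoint L | pushforward φ x = x}) ≤ d + 1 := by
  subst hdeg
  classical
  have hlt : (X : L[X]).natDegree < φ.natDegree := by rw [natDegree_X]; omega
  have hdegree : (φ - X).natDegree = φ.natDegree := natDegree_sub_eq_left_of_natDegree_lt hlt
  have hne : φ - X ≠ 0 := by
    rintro h
    rw [h, natDegree_zero] at hdegree
    omega
  let F := {x : BerkovichPoint L | pushforward φ x = x}
  have hkey (x : F) : ∃ o : Option (φ - X).roots.toFinset,
      (∀ a, o = some a → x.1 = evPoint a.1) ∧ (o = none → 0 < x.1.radius) := by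
    rcases x.1.radius_nonneg.eq_or_lt with h | h
    · obtain ⟨a, ha⟩ := exists_eq_evPoint_of_radius_eq_zero h.symm
      have hfix : pushforward φ (evPoint a) = evPoint a := ha ▸ x.2
      have hroot : a ∈ (φ - X).roots.toFinset := by
        simp [hne, eval_eq_of_pushforward_evPoint_eq hfix]
      exact ⟨some ⟨a, hroot⟩, by rintro _ ⟨⟩; exact ha, by simp⟩
    · exact ⟨none, by simp, fun _ ↦ h⟩
  choose f hsome hnone using hkey
  let rep := Function.surjInv (ConnectedComponents.surjective_coe (α := F))
  have hrep (c : ConnectedComponents F) : (rep c : ConnectedComponents F) = c :=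
    Function.surjInv_eq _ c
  have hinj : Function.Injective fun c ↦ f (rep c) := by
    intro c₁ c₂ h
    change f (rep c₁) = f (rep c₂) at h
    rw [← hrep c₁, ← hrep c₂, ConnectedComponents.coe_eq_coe]
    generalize rep c₁ = x at h
    generalize rep c₂ = y at h
    cases hx : f x with
    | none =>
      exact connectedComponent_eq_of_radius_pos hna hd hcoeff hlead x y (hnone x hx)
        (hnone y (h ▸ hx))
    | some a =>
      rw [Subtype.ext ((hsome x a hx).trans (hsome y a (h ▸ hx)).symm)]
  refine ⟨Finite.of_injective _ hinj, (Nat.card_le_card_of_injective _ hinj).trans ?_⟩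
  rw [Nat.card_eq_fintype_card, Fintype.card_option, Fintype.card_coe, ← hdegree]
  gcongr
  exact (Multiset.toFinset_card_le _).trans (card_roots' _)
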